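/- For every positive integer n there exists an involution Φ of the set FC(B_n) of fully commutative elements of B_n such that for every w∈FC(B_n): Des_B(Φ(w))=Des_B(w), Neg(Φ(w))=Neg(w), and bl(w^{-1}) = n − ldes(Φ(w)^{-1}) (equivalently, bl(Φ(w)^{-1}) = n − ldes(w^{-1})). -/

import Mathlib

open scoped Classical

noncomputable section

namespace Paper

/-- Membership in the hyperoctahedral group `B_n`, realized inside `Equiv.Perm ℤ`:
`w(-i) = -w(i)` and `w` fixes every integer of absolute value larger than `n`. -/
def InB (n : ℕ) (w : Equiv.Perm ℤ) : Prop :=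
  (∀ i : ℤ, w (-i) = - w i) ∧ ∀ i : ℤ, (n : ℤ) < |i| → w i = i

/-- Window entry `w_i` with the convention `w_0 = 0`. -/
def went (w : Equiv.Perm ℤ) (i : ℕ) : ℤ := if i = 0 then 0 else w (i : ℤ)

/-- Stembridge's pattern criterion: `w ∈ B_n` is fully commutative iff there are no
indices `i<j` with `0 > w_i > w_j`, no `i<j<k` with `|w_i| > w_j > w_k`, and no
`i<j<k` with `-w_j > |w_i| > w_k`. -/
def IsFC (n : ℕ) (w : Equiv.Perm ℤ) : Prop :=
  InB n w ∧
  (¬ ∃ i j : ℕ, 1 ≤ i ∧ i < j ∧ j ≤ n ∧ w (j : ℤ) < w (i : ℤ) ∧ w (i : ℤ) < 0) ∧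
  (¬ ∃ i j k : ℕ, 1 ≤ i ∧ i < j ∧ j < k ∧ k ≤ n ∧
      w (j : ℤ) < |w (i : ℤ)| ∧ w (k : ℤ) < w (j : ℤ)) ∧
  (¬ ∃ i j k : ℕ, 1 ≤ i ∧ i < j ∧ j < k ∧ k ≤ n ∧
      |w (i : ℤ)| < - w (j : ℤ) ∧ w (k : ℤ) < |w (i : ℤ)|)

/-- Membership in `S_n ⊆ B_n`: all window entries positive. -/
def InS (n : ℕ) (w : Equiv.Perm ℤ) : Prop :=
  InB n w ∧ ∀ i : ℕ, 1 ≤ i → i ≤ n → 0 < w (i : ℤ)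

/-- 321-avoidance of the window. -/
def Avoids321 (n : ℕ) (w : Equiv.Perm ℤ) : Prop :=
  ¬ ∃ i j k : ℕ, 1 ≤ i ∧ i < j ∧ j < k ∧ k ≤ n ∧
    w (k : ℤ) < w (j : ℤ) ∧ w (j : ℤ) < w (i : ℤ)

/-- Type-B descent set `Des_B(w) = {0 ≤ i ≤ n-1 : w_i > w_{i+1}}`, convention `w_0 = 0`. -/
def DesB (n : ℕ) (w : Equiv.Perm ℤ) : Finset ℕ :=
  (Finset.range n).filter fun i => went w (i+1) < went w i

/-- Type-A descent set `Des(w) = {1 ≤ i ≤ n-1 : w_i > w_{i+1}}`. -/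
def DesA (n : ℕ) (w : Equiv.Perm ℤ) : Finset ℕ :=
  (Finset.Ico 1 n).filter fun i => went w (i+1) < went w i

/-- Last descent: `ldes(w) = max (Des_B(w) ∪ {0})`. -/
def ldes (n : ℕ) (w : Equiv.Perm ℤ) : ℕ := (DesB n w).sup id

/-- `Neg(w) = {1 ≤ i ≤ n : w_i < 0}`. -/
def NegSet (n : ℕ) (w : Equiv.Perm ℤ) : Finset ℕ :=
  (Finset.Icc 1 n).filter fun i => w (i : ℤ) < 0

/-- Block number `bl(w) = 1 + #{1 ≤ i ≤ n-1 : max(w_1,…,w_i) < min(w_{i+1},…,w_n)}`. -/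
def bl (n : ℕ) (w : Equiv.Perm ℤ) : ℕ :=
  1 + ((Finset.Ioo 0 n).filter fun i : ℕ =>
    ∀ j ∈ Finset.Icc 1 i, ∀ k ∈ Finset.Icc (i + 1) n, w ((j : ℕ) : ℤ) < w ((k : ℕ) : ℤ)).card

/-- Chow's type-B fundamental quasi-symmetric function `F^B_J` in variables `x_0,x_1,…`:
the sum of `x_{i_1} ⋯ x_{i_n}` over `0 ≤ i_1 ≤ ⋯ ≤ i_n` with `i_j < i_{j+1}` for `j ∈ J`,
with the convention `i_0 = 0`. A sequence is encoded by `f : ℕ → ℕ` with `f a = i_a`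
for `1 ≤ a ≤ n`, normalized by `f 0 = 0` and `f a = 0` for `a > n`. -/
def FB (R : Type) [CommRing R] (n : ℕ) (J : Finset ℕ) : MvPowerSeries ℕ R :=
  fun m => (Nat.card {f : ℕ → ℕ //
    f 0 = 0 ∧ (∀ a, n < a → f a = 0) ∧
    (∀ a b, a ≤ b → b ≤ n → f a ≤ f b) ∧
    (∀ j ∈ J, f j < f (j + 1)) ∧
    ∀ v : ℕ, m v = ((Finset.Icc 1 n).filter fun a => f a = v).card} : R)

/-- Gessel's fundamental quasi-symmetric function `F_J` in variables `x_1,x_2,…`. -/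
def FA (R : Type) [CommRing R] (n : ℕ) (J : Finset ℕ) : MvPowerSeries ℕ R :=
  fun m => (Nat.card {f : ℕ → ℕ //
    f 0 = 0 ∧ (∀ a, n < a → f a = 0) ∧
    (∀ a, 1 ≤ a → a ≤ n → 1 ≤ f a) ∧
    (∀ a b, 1 ≤ a → a ≤ b → b ≤ n → f a ≤ f b) ∧
    (∀ j ∈ J, f j < f (j + 1)) ∧
    ∀ v : ℕ, m v = ((Finset.Icc 1 n).filter fun a => f a = v).card} : R)

/-- Complete homogeneous symmetric function `h_m` in the variables `x_s, x_{s+1}, …`. -/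
def hSeries (R : Type) [CommRing R] (s m : ℕ) : MvPowerSeries ℕ R :=
  fun μ => if (μ.sum fun _ v => v) = m ∧ ∀ a < s, μ a = 0 then 1 else 0

/-- Number of semistandard Young tableaux of shape `lam` (row lengths `lam 0 ≥ lam 1 ≥ …`),
with all entries `≥ s`, rows weakly increasing, columns strictly increasing,
and content `μ` (the value `v` occurs `μ v` times). Tableaux are normalized to be `0`
outside the cells of the diagram. -/
def schurCoeff (s : ℕ) (lam : ℕ → ℕ) (μ : ℕ → ℕ) : ℕ :=
  Nat.card {T : ℕ → ℕ → ℕ //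
    (∀ i j, j + 1 < lam i → T i j ≤ T i (j + 1)) ∧
    (∀ i j, j < lam (i + 1) → T i j < T (i + 1) j) ∧
    (∀ i j, j < lam i → s ≤ T i j) ∧
    (∀ i j, ¬ j < lam i → T i j = 0) ∧
    ∀ v : ℕ, μ v = Nat.card {p : ℕ × ℕ // p.2 < lam p.1 ∧ T p.1 p.2 = v}}

/-- The Schur function `s_lam` in the variables `x_s, x_{s+1}, …`. -/
def schurS (R : Type) [CommRing R] (s : ℕ) (lam : ℕ → ℕ) : MvPowerSeries ℕ R :=
  fun m => (schurCoeff s lam (fun v => m v) : R)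

/-- The two-row shape `(a, b)` as a row-length function. -/
def twoRow (a b : ℕ) : ℕ → ℕ := fun i => if i = 0 then a else if i = 1 then b else 0

/-- Row-length function of a partition of `k`. -/
def partFun {k : ℕ} (p : Nat.Partition k) : ℕ → ℕ :=
  fun i => ((p.parts.sort (· ≤ ·)).reverse).getD i 0

/-- Conjugate of a row-length function. -/
def conjFun (lam : ℕ → ℕ) : ℕ → ℕ := fun j => Nat.card {i : ℕ // j < lam i}

/-- Descent set of the standard Young tableau of skew shape `(n,k)/(k)` (resp. of the
bi-tableau of bi-shape `((k),(n-k))`) encoded by the set `S ⊆ {1,…,n}` of entries of the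
length-`k` bottom row: `{1 ≤ i ≤ n-1 : i ∉ S, i+1 ∈ S}`. -/
def DesSet (n : ℕ) (S : Finset ℕ) : Finset ℕ :=
  (Finset.Ico 1 n).filter fun i => i ∉ S ∧ i + 1 ∈ S

/-- Last descent of the tableau encoded by `S`. -/
def ldesSet (n : ℕ) (S : Finset ℕ) : ℕ := (DesSet n S).sup id

/-- Type-B descent set of the bi-tableau encoded by `S`: add `0` when `1 ∈ S`. -/
def DesBSet (n : ℕ) (S : Finset ℕ) : Finset ℕ :=
  if 1 ∈ S then insert 0 (DesSet n S) else DesSet n S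

/-- `b_{n,k,j}`: the number of standard Young tableaux of skew shape `(n,k)/(k)`
(encoded by `k`-subsets `S ⊆ {1,…,n}`) with `ldes = n - j`. -/
def bCoeff (n k j : ℕ) : ℕ :=
  ((Finset.Icc 1 n).powerset.filter fun S => S.card = k ∧ ldesSet n S = n - j).card

/-- `a_{n,k,j}`: the number of standard Young tableaux of shape `(n-k,k)` (encoded by
`k`-subsets `S ⊆ {1,…,n}` of second-row entries satisfying the ballot condition)
with `ldes = n - j`. -/
def aCoeff (n k j : ℕ) : ℕ :=
  ((Finset.Icc 1 n).powerset.filter fun S => S.card = k ∧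
    (∀ i ∈ Finset.Icc 1 n, 2 * (S.filter (· ≤ i)).card ≤ i) ∧ ldesSet n S = n - j).card

/-- `e_{n,m,J}`: number of `m`-subsets `S ⊆ {1,…,n}` with `Des_B(S) = J`. -/
def eCoeff (n m : ℕ) (J : Finset ℕ) : ℕ :=
  ((Finset.Icc 1 n).powerset.filter fun S => S.card = m ∧ DesBSet n S = J).card

/-- `d_{n,m,j}`: number of `m`-subsets `S ⊆ {1,…,n}` with `ldes(S) = n - j`. -/
def dCoeff (n m j : ℕ) : ℕ :=
  ((Finset.Icc 1 n).powerset.filter fun S => S.card = m ∧ ldesSet n S = n - j).card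

/-- The palindromic representation `w^0 = [-w_n, …, -w_1, w_1, …, w_n]`,
as a function of the position `p ∈ {1,…,2n}`. -/
def wzero (n : ℕ) (w : Equiv.Perm ℤ) : ℕ → ℤ :=
  fun p => if p ≤ n then - w ((n : ℤ) + 1 - (p : ℤ)) else w ((p : ℤ) - (n : ℤ))

/-- Greene invariant: the maximal total size of a union of `j` increasing subsequences
of `w^0` (a set of positions is such a union iff it admits a coloring by `j` colors with
each color class increasing). By Greene's theorem this equals `λ_1 + ⋯ + λ_j` for the
RSK shape `λ(w^0)`. -/
def greene (n : ℕ) (w : Equiv.Perm ℤ) (j : ℕ) : ℕ :=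
  ((Finset.Icc 1 (2 * n)).powerset.filter fun P =>
    ∃ c : ℕ → Fin j, ∀ p ∈ P, ∀ q ∈ P, p < q → c p = c q →
      wzero n w p < wzero n w q).sup Finset.card

/-- First valley `v(π)`. -/
def firstValley (n : ℕ) (π : Equiv.Perm ℤ) : ℕ :=
  if h : ((DesA n π⁻¹).erase 1).Nonempty then ((DesA n π⁻¹).erase 1).min' h else n

/-- Order key for the order `-1 <r -2 <r ⋯ <r -n <r 1 <r ⋯ <r n`. -/
def rkey (n : ℕ) (a : ℤ) : ℤ := if a < 0 then -a else a + n

/-- The r-descent set `rDes(w) = {1 ≤ i ≤ n-1 : w_i >r w_{i+1}}`. -/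
def rDes (n : ℕ) (w : Equiv.Perm ℤ) : Finset ℕ :=
  (Finset.Ico 1 n).filter fun i : ℕ =>
    rkey n (w (((i : ℕ) + 1 : ℕ) : ℤ)) < rkey n (w ((i : ℕ) : ℤ))

/-- Poirier's type-B quasi-symmetric function `F^P_w(X,Y)`, a power series in the two
alphabets `x_1,x_2,…` (indexed by `Sum.inl`) and `y_1,y_2,…` (indexed by `Sum.inr`). -/
def FP (n : ℕ) (w : Equiv.Perm ℤ) : MvPowerSeries (ℕ ⊕ ℕ) ℤ :=
  fun m => (Nat.card {f : ℕ → ℕ //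
    f 0 = 0 ∧ (∀ a, n < a → f a = 0) ∧
    (∀ a, 1 ≤ a → a ≤ n → 1 ≤ f a) ∧
    (∀ a b, 1 ≤ a → a ≤ b → b ≤ n → f a ≤ f b) ∧
    (∀ j ∈ rDes n w, f j < f (j + 1)) ∧
    (∀ v : ℕ, m (Sum.inl v) =
      ((Finset.Icc 1 n).filter fun a => f a = v ∧ 0 < w ((a : ℕ) : ℤ)).card) ∧
    ∀ v : ℕ, m (Sum.inr v) =
      ((Finset.Icc 1 n).filter fun a => f a = v ∧ w ((a : ℕ) : ℤ) < 0).card} : ℤ)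

/-- The Schur function `s_lam(X)` in the first alphabet `x_1,x_2,…`. -/
def schurX (lam : ℕ → ℕ) : MvPowerSeries (ℕ ⊕ ℕ) ℤ :=
  fun m => if ∀ v, m (Sum.inr v) = 0 then
    (schurCoeff 1 lam fun v => m (Sum.inl v) : ℤ) else 0

/-- The Schur function `s_lam(Y)` in the second alphabet `y_1,y_2,…`. -/
def schurY (lam : ℕ → ℕ) : MvPowerSeries (ℕ ⊕ ℕ) ℤ :=
  fun m => if ∀ v, m (Sum.inl v) = 0 then
    (schurCoeff 1 lam fun v => m (Sum.inr v) : ℤ) else 0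

/-- Chow type-B Schur-positivity: a nonnegative combination of the products
`s_{λ⁻}(x_1,x_2,…) ⋅ s_{λ⁺}(x_0,x_1,…)` over pairs of partitions of total size `n`. -/
def ChowPos (n : ℕ) (F : MvPowerSeries ℕ ℤ) : Prop :=
  ∃ c : (Σ k : Fin (n + 1), Nat.Partition (k : ℕ) × Nat.Partition (n - (k : ℕ))) → ℕ,
    F = ∑ p : (Σ k : Fin (n + 1), Nat.Partition (k : ℕ) × Nat.Partition (n - (k : ℕ))),
      (c p : ℤ) • (schurS ℤ 1 (partFun p.2.1) * schurS ℤ 0 (partFun p.2.2))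

/-- The positions `i` counted by `bl`. -/
def cutSet (n : ℕ) (u : Equiv.Perm ℤ) : Finset ℕ :=
  (Finset.Ioo 0 n).filter fun i : ℕ =>
    ∀ j ∈ Finset.Icc 1 i, ∀ k ∈ Finset.Icc (i + 1) n, u ((j : ℕ) : ℤ) < u ((k : ℕ) : ℤ)

lemma mem_cutSet {n : ℕ} {u : Equiv.Perm ℤ} {i : ℕ} :
    i ∈ cutSet n u ↔ (0 < i ∧ i < n) ∧
      ∀ j : ℕ, 1 ≤ j → j ≤ i → ∀ k : ℕ, i + 1 ≤ k → k ≤ n → u j < u k := by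
  simp [cutSet]

lemma bl_eq (n : ℕ) (u : Equiv.Perm ℤ) : bl n u = 1 + (cutSet n u).card := rfl

lemma mem_DesB {n : ℕ} {u : Equiv.Perm ℤ} {i : ℕ} :
    i ∈ DesB n u ↔ i < n ∧ went u (i + 1) < went u i := by
  simp [DesB]

lemma went_pos (u : Equiv.Perm ℤ) {i : ℕ} (hi : 0 < i) : went u i = u i := by
  simp [went, hi.ne']

/-! ### The last descent -/

lemma lt_succ_of_ldes_lt {n i : ℕ} {u : Equiv.Perm ℤ} (h : ldes n u < i) (hi : i < n) :
    u i ≤ u ((i + 1 : ℕ) : ℤ) := by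
  by_contra hc
  have : i ∈ DesB n u := by
    rw [mem_DesB, went_pos _ (by omega), went_pos _ (by omega)]
    exact ⟨hi, by omega⟩
  have h2 : i ≤ ldes n u := Finset.le_sup (f := id) this
  omega

lemma lt_of_ldes_lt {n y z : ℕ} {u : Equiv.Perm ℤ} (h : ldes n u < y) (hyz : y < z)
    (hz : z ≤ n) : u y < u z := by
  have key : ∀ d : ℕ, y + d ≤ n → u y ≤ u ((y + d : ℕ) : ℤ) := by
    intro d
    induction d with
    | zero => intro _; simp
    | succ d ih =>
      intro hd
      exact (ih (by omega)).trans (lt_succ_of_ldes_lt (n := n) (i := y + d) (by omega) (by omega))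
  have h1 := key (z - y) (by omega)
  rw [Nat.add_sub_cancel' hyz.le] at h1
  refine lt_of_le_of_ne h1 fun he => ?_
  have := u.injective he
  omega

lemma ldes_spec {n : ℕ} {u : Equiv.Perm ℤ} (h : 0 < ldes n u) :
    ldes n u < n ∧ u ((ldes n u + 1 : ℕ) : ℤ) < u (ldes n u) := by
  have hne : (DesB n u).Nonempty := by
    rw [Finset.nonempty_iff_ne_empty]
    intro he
    simp [ldes, he] at h
  obtain ⟨i, hi, hi'⟩ := Finset.exists_mem_eq_sup (DesB n u) hne id
  have e : ldes n u = i := hi'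
  rw [mem_DesB] at hi
  rw [went_pos _ (by omega), went_pos _ (by omega)] at hi
  rw [e]
  exact hi

lemma ldes_eq {n M : ℕ} {u : Equiv.Perm ℤ}
    (h : M = 0 ∨ (M < n ∧ u ((M + 1 : ℕ) : ℤ) < u M))
    (h' : ∀ i : ℕ, M < i → i < n → u i < u ((i + 1 : ℕ) : ℤ)) : ldes n u = M := by
  have h1 : ldes n u ≤ M := by
    by_contra hc
    obtain ⟨h2, h3⟩ := ldes_spec (n := n) (u := u) (by omega)
    have := h' _ (not_le.mp hc) h2
    omega
  rcases h with h | ⟨h, h2⟩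
  · omega
  · by_contra hc
    have := lt_of_ldes_lt (n := n) (u := u) (y := M) (z := M + 1) (by omega) (by omega) (by omega)
    omega

/-! ### Signed permutations -/

lemma InB.abs_le {n : ℕ} {w : Equiv.Perm ℤ} (hw : InB n w) {i : ℤ} (hi : |i| ≤ n) :
    |w i| ≤ n := by
  by_contra hc
  have h1 := w.injective (hw.2 (w i) (by omega))
  rw [h1] at hc
  exact hc hi

lemma InB.bounds {n : ℕ} {w : Equiv.Perm ℤ} (hw : InB n w) {i : ℤ} (h1 : -(n : ℤ) ≤ i)
    (h2 : i ≤ n) : -(n : ℤ) ≤ w i ∧ w i ≤ n :=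
  _root_.abs_le.mp (hw.abs_le (_root_.abs_le.mpr ⟨h1, h2⟩))

lemma InB.zero {n : ℕ} {w : Equiv.Perm ℤ} (hw : InB n w) : w 0 = 0 := by
  have := hw.1 0
  simp only [neg_zero] at this
  omega

lemma InB.ne_zero {n : ℕ} {w : Equiv.Perm ℤ} (hw : InB n w) {i : ℤ} (hi : i ≠ 0) : w i ≠ 0 :=
  fun h => hi (w.injective (h.trans hw.zero.symm))

lemma InB.inv {n : ℕ} {w : Equiv.Perm ℤ} (hw : InB n w) : InB n w⁻¹ := by
  refine ⟨fun i => ?_, fun i hi => ?_⟩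
  · have h : w (w⁻¹ i) = i := Equiv.apply_symm_apply w i
    rw [Equiv.Perm.inv_eq_iff_eq, hw.1, h]
  · rw [Equiv.Perm.inv_eq_iff_eq, hw.2 i hi]

lemma InB.mono {n m : ℕ} (h : n ≤ m) {w : Equiv.Perm ℤ} (hw : InB n w) : InB m w :=
  ⟨hw.1, fun i hi => hw.2 i (by omega)⟩

lemma InB.mul {n : ℕ} {w z : Equiv.Perm ℤ} (hw : InB n w) (hz : InB n z) : InB n (w * z) :=
  ⟨fun i => by simp [hw.1, hz.1], fun i hi => by simp [hz.2 i hi, hw.2 i hi]⟩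

lemma InB.of_succ {n : ℕ} {w : Equiv.Perm ℤ} (hw : InB (n + 1) w)
    (h : w ((n + 1 : ℕ) : ℤ) = (n + 1 : ℕ)) : InB n w := by
  refine ⟨hw.1, fun i hi => ?_⟩
  rcases eq_or_ne |i| ((n + 1 : ℕ) : ℤ) with h1 | h1
  · rcases eq_or_eq_neg_of_abs_eq h1 with h2 | h2
    · rw [h2, h]
    · rw [h2, hw.1, h]
  · exact hw.2 i (by omega)

lemma InB.apply_inv_neg {n : ℕ} {w : Equiv.Perm ℤ} (hw : InB n w) {i y : ℤ} (h : w i = -y) :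
    w⁻¹ y = -i := by
  rw [Equiv.Perm.inv_eq_iff_eq, hw.1, h, neg_neg]

/-- The letter of absolute value `y` in the window of `w`. -/
lemma InB.exists_pos {n y : ℕ} {w : Equiv.Perm ℤ} (hw : InB n w) (h1 : 1 ≤ y) (h2 : y ≤ n) :
    ∃ i : ℕ, 1 ≤ i ∧ i ≤ n ∧
      ((w i = y ∧ w⁻¹ (y : ℤ) = i) ∨ (w i = -y ∧ w⁻¹ (y : ℤ) = -i)) := by
  have hb := hw.inv.bounds (i := y) (by omega) (by omega)
  have h0 := hw.inv.ne_zero (i := y) (by omega)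
  have ha : w (w⁻¹ (y : ℤ)) = y := Equiv.apply_symm_apply w _
  refine ⟨(w⁻¹ (y : ℤ)).natAbs, by omega, by omega, ?_⟩
  rcases le_total 0 (w⁻¹ (y : ℤ)) with h | h
  · left
    rw [Int.natAbs_of_nonneg h]
    exact ⟨ha, rfl⟩
  · right
    rw [Int.ofNat_natAbs_of_nonpos h, hw.1, ha]
    simp

/-! ### Inserting a last letter -/

/-- The signed cycle in `B_{n+1}` sending `n+1` to `v` and shifting `v, …, n` up by one;
left multiplication of `w ∈ B_n` by it appends the letter `v` to the window of `w`. -/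
def cyc (n v : ℕ) : Equiv.Perm ℤ :=
  if h : 1 ≤ v ∧ v ≤ n + 1 then
    { toFun := fun y => if y = n + 1 then v else if y = -(n + 1) then -v else
        if v ≤ y ∧ y ≤ n then y + 1 else if y ≤ -v ∧ -n ≤ y then y - 1 else y
      invFun := fun y => if y = v then n + 1 else if y = -v then -(n + 1) else
        if v < y ∧ y ≤ n + 1 then y - 1 else if y < -v ∧ -(n + 1) ≤ y then y + 1 else y
      left_inv := fun y => by
        dsimp only
        split_ifs <;> omega
      right_inv := fun y => by
        dsimp only
        split_ifs <;> omega }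
  else 1

lemma cyc_apply {n v : ℕ} (h1 : 1 ≤ v) (h2 : v ≤ n + 1) (y : ℤ) :
    cyc n v y = if y = n + 1 then (v : ℤ) else if y = -(n + 1) then -(v : ℤ) else
        if v ≤ y ∧ y ≤ n then y + 1 else if y ≤ -v ∧ -n ≤ y then y - 1 else y := by
  rw [cyc, dif_pos ⟨h1, h2⟩]
  rfl

lemma cyc_inv_apply {n v : ℕ} (h1 : 1 ≤ v) (h2 : v ≤ n + 1) (y : ℤ) :
    (cyc n v)⁻¹ y = if y = v then (n + 1 : ℤ) else if y = -v then -(n + 1 : ℤ) else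
        if v < y ∧ y ≤ n + 1 then y - 1 else if y < -v ∧ -(n + 1) ≤ y then y + 1 else y := by
  rw [cyc, dif_pos ⟨h1, h2⟩]
  rfl

lemma cyc_last {n v : ℕ} (h1 : 1 ≤ v) (h2 : v ≤ n + 1) :
    cyc n v ((n + 1 : ℕ) : ℤ) = v := by
  rw [cyc_apply h1 h2]
  simp

lemma InB_cyc {n v : ℕ} (h1 : 1 ≤ v) (h2 : v ≤ n + 1) : InB (n + 1) (cyc n v) := by
  refine ⟨fun i => ?_, fun i hi => ?_⟩
  · rw [cyc_apply h1 h2, cyc_apply h1 h2]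
    split_ifs <;> omega
  · rw [cyc_apply h1 h2]
    rw [lt_abs] at hi
    split_ifs <;> omega

lemma InB.cyc_mul {n v : ℕ} (h1 : 1 ≤ v) (h2 : v ≤ n + 1) {w : Equiv.Perm ℤ} (hw : InB n w) :
    InB (n + 1) (cyc n v * w) :=
  (InB_cyc h1 h2).mul (hw.mono (by omega))

lemma InB.apply_succ {n : ℕ} {w : Equiv.Perm ℤ} (hw : InB n w) :
    w ((n + 1 : ℕ) : ℤ) = (n + 1 : ℕ) :=
  hw.2 _ (by rw [abs_of_nonneg (by omega)]; omega)

lemma InB.cyc_mul_last {n v : ℕ} (h1 : 1 ≤ v) (h2 : v ≤ n + 1) {w : Equiv.Perm ℤ}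
    (hw : InB n w) : (cyc n v * w) ((n + 1 : ℕ) : ℤ) = v := by
  rw [Equiv.Perm.mul_apply, hw.apply_succ, cyc_last h1 h2]

lemma InB.del {n v : ℕ} (h1 : 1 ≤ v) (h2 : v ≤ n + 1) {w : Equiv.Perm ℤ}
    (hw : InB (n + 1) w) (h : w ((n + 1 : ℕ) : ℤ) = v) : InB n ((cyc n v)⁻¹ * w) := by
  refine InB.of_succ ((InB_cyc h1 h2).inv.mul hw) ?_
  rw [Equiv.Perm.mul_apply, h, Equiv.Perm.inv_eq_iff_eq, cyc_last h1 h2]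

/-- How `cyc n v` acts on letters of absolute value at most `n`. -/
lemma cyc_cases {n v : ℕ} (h1 : 1 ≤ v) (h2 : v ≤ n + 1) {y : ℤ} (hy : -(n : ℤ) ≤ y)
    (hy' : y ≤ n) : (v ≤ y ∧ cyc n v y = y + 1) ∨ (y ≤ -v ∧ cyc n v y = y - 1) ∨
      (-v < y ∧ y < v ∧ cyc n v y = y) := by
  rw [cyc_apply h1 h2]
  split_ifs <;> omega

lemma cyc_lt_iff {n v : ℕ} (h1 : 1 ≤ v) (h2 : v ≤ n + 1) {y z : ℤ} (hy : -(n : ℤ) ≤ y ∧ y ≤ n)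
    (hz : -(n : ℤ) ≤ z ∧ z ≤ n) : cyc n v y < cyc n v z ↔ y < z := by
  have a := cyc_cases h1 h2 hy.1 hy.2
  have b := cyc_cases h1 h2 hz.1 hz.2
  omega

lemma cyc_neg_iff {n v : ℕ} (h1 : 1 ≤ v) (h2 : v ≤ n + 1) {y : ℤ}
    (hy : -(n : ℤ) ≤ y ∧ y ≤ n) : cyc n v y < 0 ↔ y < 0 := by
  have a := cyc_cases h1 h2 hy.1 hy.2
  omega

lemma cyc_lt_self_iff {n v : ℕ} (h1 : 1 ≤ v) (h2 : v ≤ n + 1) {y : ℤ}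
    (hy : -(n : ℤ) ≤ y ∧ y ≤ n) : v < cyc n v y ↔ v ≤ y := by
  have a := cyc_cases h1 h2 hy.1 hy.2
  omega

lemma abs_cyc {n v : ℕ} (h1 : 1 ≤ v) (h2 : v ≤ n + 1) {y : ℤ}
    (hy : -(n : ℤ) ≤ y ∧ y ≤ n) : |cyc n v y| = cyc n v |y| := by
  have a := cyc_cases h1 h2 hy.1 hy.2
  rcases le_total 0 y with h | h
  · rw [abs_of_nonneg h, abs_of_nonneg (by omega)]
  · rw [abs_of_nonpos h, abs_of_nonpos (by omega), (InB_cyc h1 h2).1]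

/-! ### Full commutativity -/

lemma IsFC.le_of_neg {n i j : ℕ} {w : Equiv.Perm ℤ} (hw : IsFC n w) (hi : 1 ≤ i) (hij : i < j)
    (hj : j ≤ n) (h : w i < 0) : w i ≤ w j := by
  by_contra hc
  exact hw.2.1 ⟨i, j, hi, hij, hj, by omega, h⟩

lemma IsFC.le_of_lt_abs {n i j k : ℕ} {w : Equiv.Perm ℤ} (hw : IsFC n w) (hi : 1 ≤ i)
    (hij : i < j) (hjk : j < k) (hk : k ≤ n) (h : w j < |w i|) : w j ≤ w k := by
  by_contra hc
  exact hw.2.2.1 ⟨i, j, k, hi, hij, hjk, hk, h, by omega⟩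

lemma IsFC.abs_le_of_abs_lt {n i j k : ℕ} {w : Equiv.Perm ℤ} (hw : IsFC n w) (hi : 1 ≤ i)
    (hij : i < j) (hjk : j < k) (hk : k ≤ n) (h : |w i| < -w j) : |w i| ≤ w k := by
  by_contra hc
  exact hw.2.2.2 ⟨i, j, k, hi, hij, hjk, hk, h, by omega⟩

lemma IsFC.of_succ {n : ℕ} {w : Equiv.Perm ℤ} (hw : IsFC (n + 1) w) (h : InB n w) : IsFC n w :=
  ⟨h, fun ⟨i, j, h1, h2, h3, h4⟩ => hw.2.1 ⟨i, j, h1, h2, by omega, h4⟩,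
    fun ⟨i, j, k, h1, h2, h3, h4, h5⟩ => hw.2.2.1 ⟨i, j, k, h1, h2, h3, by omega, h5⟩,
    fun ⟨i, j, k, h1, h2, h3, h4, h5⟩ => hw.2.2.2 ⟨i, j, k, h1, h2, h3, by omega, h5⟩⟩

/-- An inversion of the inverse lies at or before its last descent. -/
lemma le_ldes_of_inversion {n y z : ℕ} {u : Equiv.Perm ℤ} (hyz : y < z) (hz : z ≤ n)
    (h : u z < u y) : y ≤ ldes n u := by
  by_contra hc
  have := lt_of_ldes_lt (u := u) (not_le.mp hc) hyz hz
  omega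

lemma InB.le_ldes_of_lt_abs {n i j : ℕ} {w : Equiv.Perm ℤ} (hw : InB n w)
    (hij : i < j) (hj : j ≤ n) (h : w j < |w i|) : w j ≤ ldes n w⁻¹ := by
  rcases le_or_gt (w j) 0 with h0 | h0
  · omega
  obtain ⟨y, hy⟩ := Int.eq_ofNat_of_zero_le h0.le
  have hb := hw.bounds (i := i) (by omega) (by omega)
  have hu : w⁻¹ (y : ℤ) = j := by rw [Equiv.Perm.inv_eq_iff_eq, hy]
  rw [hy] at h ⊢
  rw [lt_abs] at h
  have hz : w⁻¹ (((w i).natAbs : ℕ) : ℤ) < w⁻¹ (y : ℤ) := by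
    rw [hu]
    rcases le_total 0 (w i) with h1 | h1
    · rw [Int.natAbs_of_nonneg h1]
      have : w⁻¹ (w i) = i := Equiv.symm_apply_apply w _
      omega
    · rw [Int.ofNat_natAbs_of_nonpos h1, hw.inv.1]
      have : w⁻¹ (w i) = i := Equiv.symm_apply_apply w _
      omega
  have := le_ldes_of_inversion (n := n) (u := w⁻¹) (by omega) (by omega) hz
  exact_mod_cast this

lemma InB.abs_le_ldes_of_abs_lt {n i j : ℕ} {w : Equiv.Perm ℤ} (hw : InB n w)
    (hij : i < j) (hj : j ≤ n) (h : |w i| < -w j) : |w i| ≤ ldes n w⁻¹ := by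
  have hb := hw.bounds (i := j) (by omega) (by omega)
  have h0 := abs_nonneg (w i)
  obtain ⟨z, hz⟩ := Int.eq_ofNat_of_zero_le (a := -w j) (by omega)
  have hu : w⁻¹ (z : ℤ) = -j := hw.apply_inv_neg (by omega)
  rw [Int.abs_eq_natAbs] at h ⊢
  have hy : w⁻¹ (z : ℤ) < w⁻¹ (((w i).natAbs : ℕ) : ℤ) := by
    rw [hu]
    have : w⁻¹ (w i) = i := Equiv.symm_apply_apply w _
    rcases le_total 0 (w i) with h1 | h1
    · rw [Int.natAbs_of_nonneg h1]
      omega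
    · rw [Int.ofNat_natAbs_of_nonpos h1, hw.inv.1]
      omega
  have := le_ldes_of_inversion (n := n) (u := w⁻¹) (by omega) (by omega) hy
  exact_mod_cast this

lemma IsFC.exists_of_ldes_pos {n : ℕ} {w : Equiv.Perm ℤ} (hw : IsFC n w)
    (h : 0 < ldes n w⁻¹) : ∃ i j : ℕ, 1 ≤ i ∧ i < j ∧ j ≤ n ∧
      ((w j < |w i| ∧ w j = ldes n w⁻¹) ∨ (|w i| < -w j ∧ |w i| = ldes n w⁻¹)) := by
  obtain ⟨h1, h2⟩ := ldes_spec h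
  generalize ldes n w⁻¹ = M at *
  obtain ⟨p, hp1, hp2, hp⟩ := hw.1.exists_pos (y := M) (by omega) (by omega)
  obtain ⟨q, hq1, hq2, hq⟩ := hw.1.exists_pos (y := M + 1) (by omega) (by omega)
  push_cast at *
  rcases hp with ⟨hp, hp'⟩ | ⟨hp, hp'⟩ <;> rcases hq with ⟨hq, hq'⟩ | ⟨hq, hq'⟩ <;>
    rw [hp', hq'] at h2
  · refine ⟨q, p, hq1, by omega, hp2, Or.inl ⟨?_, hp⟩⟩
    rw [lt_abs]
    omega
  · rcases lt_trichotomy p q with hpq | hpq | hpq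
    · refine ⟨p, q, hp1, hpq, hq2, Or.inr ⟨?_, ?_⟩⟩
      · rw [abs_lt]
        omega
      · rw [hp]
        simp
    · subst hpq
      omega
    · refine ⟨q, p, hq1, by omega, hp2, Or.inl ⟨?_, hp⟩⟩
      rw [lt_abs]
      omega
  · omega
  · have := hw.le_of_neg (i := p) (j := q) hp1 (by omega) hq2 (by omega)
    omega

/-- Appending a positive letter beyond the last descent of the inverse. -/
lemma IsFC.cyc_mul {n v : ℕ} {w : Equiv.Perm ℤ} (hw : IsFC n w) (hv : ldes n w⁻¹ < v)
    (hv' : v ≤ n + 1) : IsFC (n + 1) (cyc n v * w) := by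
  have h1 : 1 ≤ v := by omega
  have hl := hw.1.cyc_mul_last h1 hv'
  have B : ∀ i : ℕ, i ≤ n → -(n : ℤ) ≤ w i ∧ w i ≤ n := fun i hi =>
    hw.1.bounds (by omega) (by omega)
  have BA : ∀ i : ℕ, i ≤ n → -(n : ℤ) ≤ |w i| ∧ |w i| ≤ n := fun i hi =>
    ⟨by have := abs_nonneg (w i); omega, hw.1.abs_le (by simpa using hi)⟩
  have BN : ∀ i : ℕ, i ≤ n → -(n : ℤ) ≤ -w i ∧ -w i ≤ n := fun i hi => by
    have := B i hi
    omega
  refine ⟨hw.1.cyc_mul h1 hv', ?_, ?_, ?_⟩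
  · rintro ⟨i, j, hi, hij, hj, h2, h3⟩
    rcases eq_or_lt_of_le hj with rfl | hj
    · rw [hl] at h2
      omega
    · rw [Equiv.Perm.mul_apply, Equiv.Perm.mul_apply,
        cyc_lt_iff h1 hv' (B j (by omega)) (B i (by omega))] at h2
      rw [Equiv.Perm.mul_apply, cyc_neg_iff h1 hv' (B i (by omega))] at h3
      exact hw.2.1 ⟨i, j, hi, hij, by omega, h2, h3⟩
  · rintro ⟨i, j, k, hi, hij, hjk, hk, h2, h3⟩
    rw [Equiv.Perm.mul_apply, Equiv.Perm.mul_apply, abs_cyc h1 hv' (B i (by omega)),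
      cyc_lt_iff h1 hv' (B j (by omega)) (BA i (by omega))] at h2
    rcases eq_or_lt_of_le hk with rfl | hk
    · rw [hl, Equiv.Perm.mul_apply, cyc_lt_self_iff h1 hv' (B j (by omega))] at h3
      have := hw.1.le_ldes_of_lt_abs hij (by omega) h2
      omega
    · rw [Equiv.Perm.mul_apply, Equiv.Perm.mul_apply,
        cyc_lt_iff h1 hv' (B k (by omega)) (B j (by omega))] at h3
      exact hw.2.2.1 ⟨i, j, k, hi, hij, hjk, by omega, h2, h3⟩
  · rintro ⟨i, j, k, hi, hij, hjk, hk, h2, h3⟩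
    rw [Equiv.Perm.mul_apply, Equiv.Perm.mul_apply, abs_cyc h1 hv' (B i (by omega)),
      ← (InB_cyc h1 hv').1, cyc_lt_iff h1 hv' (BA i (by omega)) (BN j (by omega))] at h2
    rw [Equiv.Perm.mul_apply (cyc n v) w (i : ℤ), abs_cyc h1 hv' (B i (by omega))] at h3
    rcases eq_or_lt_of_le hk with rfl | hk
    · rw [hl, cyc_lt_self_iff h1 hv' (BA i (by omega))] at h3
      have := hw.1.abs_le_ldes_of_abs_lt hij (by omega) h2
      omega
    · rw [Equiv.Perm.mul_apply, cyc_lt_iff h1 hv' (B k (by omega)) (BA i (by omega))] at h3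
      exact hw.2.2.2 ⟨i, j, k, hi, hij, hjk, by omega, h2, h3⟩

/-- Deleting a positive last letter. -/
lemma IsFC.of_cyc_mul {n v : ℕ} {w : Equiv.Perm ℤ} (hb : InB n w) (h1 : 1 ≤ v)
    (hv' : v ≤ n + 1) (hw : IsFC (n + 1) (cyc n v * w)) : IsFC n w ∧ ldes n w⁻¹ < v := by
  have hl := hb.cyc_mul_last h1 hv'
  have B : ∀ i : ℕ, i ≤ n → -(n : ℤ) ≤ w i ∧ w i ≤ n := fun i hi =>
    hb.bounds (by omega) (by omega)
  have BA : ∀ i : ℕ, i ≤ n → -(n : ℤ) ≤ |w i| ∧ |w i| ≤ n := fun i hi =>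
    ⟨by have := abs_nonneg (w i); omega, hb.abs_le (by simpa using hi)⟩
  have BN : ∀ i : ℕ, i ≤ n → -(n : ℤ) ≤ -w i ∧ -w i ≤ n := fun i hi => by
    have := B i hi
    omega
  have e2 : ∀ i j : ℕ, i ≤ n → j ≤ n →
      ((cyc n v * w) j < |(cyc n v * w) i| ↔ w j < |w i|) := fun i j hi hj => by
    rw [Equiv.Perm.mul_apply, Equiv.Perm.mul_apply, abs_cyc h1 hv' (B i hi),
      cyc_lt_iff h1 hv' (B j hj) (BA i hi)]
  have e3 : ∀ i j : ℕ, i ≤ n → j ≤ n →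
      (|(cyc n v * w) i| < -(cyc n v * w) j ↔ |w i| < -w j) := fun i j hi hj => by
    rw [Equiv.Perm.mul_apply, Equiv.Perm.mul_apply, abs_cyc h1 hv' (B i hi),
      ← (InB_cyc h1 hv').1, cyc_lt_iff h1 hv' (BA i hi) (BN j hj)]
  have e1 : ∀ i j : ℕ, i ≤ n → j ≤ n →
      ((cyc n v * w) j < (cyc n v * w) i ↔ w j < w i) := fun i j hi hj => by
    rw [Equiv.Perm.mul_apply, Equiv.Perm.mul_apply, cyc_lt_iff h1 hv' (B j hj) (B i hi)]
  have hfc : IsFC n w := by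
    refine ⟨hb, ?_, ?_, ?_⟩
    · rintro ⟨i, j, hi, hij, hj, h2, h3⟩
      refine hw.2.1 ⟨i, j, hi, hij, by omega, (e1 i j (by omega) hj).2 h2, ?_⟩
      rwa [Equiv.Perm.mul_apply, cyc_neg_iff h1 hv' (B i (by omega))]
    · rintro ⟨i, j, k, hi, hij, hjk, hk, h2, h3⟩
      exact hw.2.2.1 ⟨i, j, k, hi, hij, hjk, by omega, (e2 i j (by omega) (by omega)).2 h2,
        (e1 j k (by omega) hk).2 h3⟩
    · rintro ⟨i, j, k, hi, hij, hjk, hk, h2, h3⟩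
      exact hw.2.2.2 ⟨i, j, k, hi, hij, hjk, by omega, (e3 i j (by omega) (by omega)).2 h2,
        (e2 i k (by omega) hk).2 h3⟩
  refine ⟨hfc, ?_⟩
  rcases Nat.eq_zero_or_pos (ldes n w⁻¹) with h | h
  · omega
  obtain ⟨i, j, hi, hij, hj, ⟨h2, h3⟩ | ⟨h2, h3⟩⟩ := hfc.exists_of_ldes_pos h
  · have := hw.le_of_lt_abs hi hij (Nat.lt_succ_of_le hj) le_rfl
      ((e2 i j (by omega) hj).2 h2)
    rw [hl, Equiv.Perm.mul_apply, ← not_lt, cyc_lt_self_iff h1 hv' (B j hj)] at this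
    omega
  · have := hw.abs_le_of_abs_lt hi hij (Nat.lt_succ_of_le hj) le_rfl
      ((e3 i j (by omega) hj).2 h2)
    rw [hl, Equiv.Perm.mul_apply, abs_cyc h1 hv' (B i (by omega)), ← not_lt,
      cyc_lt_self_iff h1 hv' (BA i (by omega))] at this
    omega

/-! ### Statistics -/

/-- The number of cuts of `w⁻¹` after its last descent (`n` if `w⁻¹` is increasing). -/
def lateCuts (n : ℕ) (w : Equiv.Perm ℤ) : ℕ :=
  if ldes n w⁻¹ = 0 then n else ((cutSet n w⁻¹).filter (ldes n w⁻¹ < ·)).card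

/-- The number of blocks of `w⁻¹` not accounted for by `lateCuts`. -/
def earlyBlocks (n : ℕ) (w : Equiv.Perm ℤ) : ℕ :=
  if ldes n w⁻¹ = 0 then 0 else 1 + ((cutSet n w⁻¹).filter (· < ldes n w⁻¹)).card

/-- The part of the final increasing run of `w⁻¹` not accounted for by `lateCuts`. -/
def runExcess (n : ℕ) (w : Equiv.Perm ℤ) : ℕ := n - ldes n w⁻¹ - lateCuts n w

/-- The quantity preserved when `earlyBlocks` and `runExcess` are traded for each other. -/
def total (n : ℕ) (w : Equiv.Perm ℤ) : ℕ := earlyBlocks n w + runExcess n w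

lemma eq_Ico_of_upClosed {n : ℕ} {S : Finset ℕ} (h : ∀ i ∈ S, i < n)
    (h' : ∀ i ∈ S, ∀ j, i < j → j < n → j ∈ S) : S = Finset.Ico (n - S.card) n := by
  rcases S.eq_empty_or_nonempty with rfl | hne
  · simp
  · have e : S = Finset.Ico (S.min' hne) n := by
      ext i
      rw [Finset.mem_Ico]
      refine ⟨fun hi => ⟨S.min'_le i hi, h i hi⟩, fun ⟨h1, h2⟩ => ?_⟩
      rcases eq_or_lt_of_le h1 with h3 | h3
      · rw [← h3]
        exact S.min'_mem hne
      · exact h' _ (S.min'_mem hne) _ h3 h2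
    have hm := h _ (S.min'_mem hne)
    have hc : S.card = n - S.min' hne := by
      conv_lhs => rw [e]
      simp
    rw [hc]
    conv_lhs => rw [e]
    congr 1
    omega

lemma late_cuts_upClosed {n : ℕ} {u : Equiv.Perm ℤ} :
    (cutSet n u).filter (ldes n u < ·) =
      Finset.Ico (n - ((cutSet n u).filter (ldes n u < ·)).card) n := by
  apply eq_Ico_of_upClosed
  · intro i hi
    rw [Finset.mem_filter, mem_cutSet] at hi
    exact hi.1.1.2
  · intro i hi j hij hj
    rw [Finset.mem_filter, mem_cutSet] at hi ⊢
    obtain ⟨⟨⟨h1, h2⟩, h3⟩, h4⟩ := hi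
    refine ⟨⟨⟨by omega, hj⟩, fun p hp hp' q hq hq' => ?_⟩, by omega⟩
    rcases le_or_gt p i with h | h
    · exact h3 p hp h q (by omega) hq'
    · exact lt_of_ldes_lt (n := n) (by omega) (by omega) hq'

lemma mem_cutSet_of_ldes_eq_zero {n i : ℕ} {u : Equiv.Perm ℤ} (h : ldes n u = 0) :
    i ∈ cutSet n u ↔ 0 < i ∧ i < n := by
  rw [mem_cutSet]
  exact ⟨fun h => h.1, fun h1 => ⟨h1, fun p hp hp' q hq hq' =>
    lt_of_ldes_lt (n := n) (by omega) (by omega) hq'⟩⟩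

lemma ldes_notMem_cutSet {n : ℕ} {u : Equiv.Perm ℤ} : ldes n u ∉ cutSet n u := by
  intro h
  rw [mem_cutSet] at h
  obtain ⟨h1, h2⟩ := ldes_spec h.1.1
  have := h.2 _ h.1.1 le_rfl _ le_rfl h1
  omega

lemma stats_bounds (n : ℕ) (w : Equiv.Perm ℤ) :
    ldes n w⁻¹ + runExcess n w + lateCuts n w = n ∧
    ((ldes n w⁻¹ = 0 ∧ earlyBlocks n w = 0 ∧ runExcess n w = 0) ∨
      (1 ≤ ldes n w⁻¹ ∧ 1 ≤ earlyBlocks n w ∧ 1 ≤ runExcess n w)) := by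
  unfold runExcess earlyBlocks lateCuts
  rcases Nat.eq_zero_or_pos (ldes n w⁻¹) with h | h
  · simp [h]
  · have h1 := (ldes_spec h).1
    have h2 : ((cutSet n w⁻¹).filter (ldes n w⁻¹ < ·)).card ≤
        (Finset.Ioo (ldes n w⁻¹) n).card := by
      apply Finset.card_le_card
      intro i hi
      rw [Finset.mem_filter, mem_cutSet] at hi
      rw [Finset.mem_Ioo]
      exact ⟨hi.2, hi.1.1.2⟩
    rw [Nat.card_Ioo] at h2
    rw [if_neg h.ne', if_neg h.ne']
    omega

/-- The cuts of `w⁻¹` below a position beyond the last descent. -/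
lemma card_cuts_lt {n v : ℕ} {w : Equiv.Perm ℤ} (h : ldes n w⁻¹ < v) (hv : v ≤ n) :
    ((cutSet n w⁻¹).filter (· < v)).card + 1 = earlyBlocks n w + (v - (n - lateCuts n w)) := by
  unfold earlyBlocks lateCuts
  rcases Nat.eq_zero_or_pos (ldes n w⁻¹) with h0 | h0
  · have e : (cutSet n w⁻¹).filter (· < v) = Finset.Ioo 0 v := by
      ext i
      rw [Finset.mem_filter, mem_cutSet_of_ldes_eq_zero h0, Finset.mem_Ioo]
      omega
    rw [e, Nat.card_Ioo, if_pos h0, if_pos h0]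
    omega
  · rw [if_neg h0.ne', if_neg h0.ne']
    have e : (cutSet n w⁻¹).filter (· < v) = (cutSet n w⁻¹).filter (· < ldes n w⁻¹) ∪
        ((cutSet n w⁻¹).filter (ldes n w⁻¹ < ·)).filter (· < v) := by
      ext i
      simp only [Finset.mem_filter, Finset.mem_union]
      constructor
      · rintro ⟨h1, h2⟩
        rcases lt_trichotomy i (ldes n w⁻¹) with h3 | h3 | h3
        · exact Or.inl ⟨h1, h3⟩
        · rw [h3] at h1
          exact absurd h1 ldes_notMem_cutSet
        · exact Or.inr ⟨⟨h1, h3⟩, h2⟩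
      · rintro (⟨h1, h2⟩ | ⟨⟨h1, h2⟩, h3⟩)
        · exact ⟨h1, by omega⟩
        · exact ⟨h1, h3⟩
    rw [e, Finset.card_union_of_disjoint]
    · have e2 : (((cutSet n w⁻¹).filter (ldes n w⁻¹ < ·)).filter (· < v)).card =
          v - (n - ((cutSet n w⁻¹).filter (ldes n w⁻¹ < ·)).card) := by
        generalize hS : (cutSet n w⁻¹).filter (ldes n w⁻¹ < ·) = S
        have hS' : S = Finset.Ico (n - S.card) n := by
          rw [← hS]
          exact late_cuts_upClosed
        have e3 : S.filter (· < v) = Finset.Ico (n - S.card) v := by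
          ext i
          rw [Finset.mem_filter, Finset.mem_Ico]
          conv_lhs => rw [hS', Finset.mem_Ico]
          omega
        rw [e3, Nat.card_Ico]
      rw [e2]
      omega
    · rw [Finset.disjoint_left]
      intro i hi hi'
      simp only [Finset.mem_filter] at hi hi'
      omega

lemma bl_inv_eq {n : ℕ} (hn : 0 < n) (w : Equiv.Perm ℤ) :
    bl n w⁻¹ = earlyBlocks n w + lateCuts n w := by
  have hM : ldes n w⁻¹ < n := by
    rcases Nat.eq_zero_or_pos (ldes n w⁻¹) with h | h
    · omega
    · exact (ldes_spec h).1
  have h1 := card_cuts_lt hM le_rfl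
  have h2 := stats_bounds n w
  have e : (cutSet n w⁻¹).filter (· < n) = cutSet n w⁻¹ := by
    apply Finset.filter_true_of_mem
    intro i hi
    exact (mem_cutSet.1 hi).1.2
  rw [e] at h1
  rw [bl_eq]
  omega

/-! ### Statistics of an appended letter -/

section append

variable {n v : ℕ} {w : Equiv.Perm ℤ}

lemma InB.inv_cyc_mul_cases (hw : InB n w) (h1 : 1 ≤ v) (h2 : v ≤ n + 1) (y : ℕ)
    (hy : y ≤ n + 1) :
    (y < v ∧ (cyc n v * w)⁻¹ (y : ℤ) = w⁻¹ (y : ℤ)) ∨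
    (y = v ∧ (cyc n v * w)⁻¹ (y : ℤ) = n + 1) ∨
    (v < y ∧ (cyc n v * w)⁻¹ (y : ℤ) = w⁻¹ ((y - 1 : ℕ) : ℤ)) := by
  rw [mul_inv_rev, Equiv.Perm.mul_apply, cyc_inv_apply h1 h2]
  rcases lt_trichotomy y v with h | h | h
  · left
    refine ⟨h, ?_⟩
    rw [if_neg (by omega), if_neg (by omega), if_neg (by omega), if_neg (by omega)]
  · right; left
    refine ⟨h, ?_⟩
    rw [if_pos (by omega)]
    have := hw.inv.apply_succ
    push_cast at this
    exact this
  · right; right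
    refine ⟨h, ?_⟩
    rw [if_neg (by omega), if_neg (by omega), if_pos (by omega), Nat.cast_sub (by omega)]
    rfl

lemma InB.ldes_cyc_mul (hw : InB n w) (h : ldes n w⁻¹ < v) (hv : v ≤ n) :
    ldes (n + 1) (cyc n v * w)⁻¹ = v := by
  have C := hw.inv_cyc_mul_cases (v := v) (by omega) (by omega)
  apply ldes_eq
  · right
    refine ⟨by omega, ?_⟩
    have c1 := C v (by omega)
    have c2 := C (v + 1) (by omega)
    have := hw.inv.bounds (i := v) (by omega) (by omega)
    simp only [Nat.add_sub_cancel] at c2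
    omega
  · intro i hi hi'
    have c1 := C i (by omega)
    have c2 := C (i + 1) (by omega)
    simp only [Nat.add_sub_cancel] at c2
    have := lt_of_ldes_lt (n := n) (u := w⁻¹) (y := i - 1) (z := i) (by omega) (by omega)
      (by omega)
    omega

lemma InB.cutSet_cyc_mul (hw : InB n w) (h : ldes n w⁻¹ < v) (hv : v ≤ n) :
    cutSet (n + 1) (cyc n v * w)⁻¹ = (cutSet n w⁻¹).filter (· < v) := by
  have C := hw.inv_cyc_mul_cases (v := v) (by omega) (by omega)
  have B : ∀ i : ℕ, i ≤ n → w⁻¹ (i : ℤ) ≤ n := fun i hi =>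
    (hw.inv.bounds (i := i) (by omega) (by omega)).2
  ext i
  rw [Finset.mem_filter, mem_cutSet, mem_cutSet]
  constructor
  · rintro ⟨⟨h1, h2⟩, h3⟩
    have hi : i < v := by
      by_contra hc
      have := h3 v (by omega) (by omega) (n + 1) (by omega) le_rfl
      have c1 := C v (by omega)
      have c2 := C (n + 1) (by omega)
      simp only [Nat.add_sub_cancel] at c2
      have := B n le_rfl
      omega
    refine ⟨⟨⟨h1, by omega⟩, fun p hp hp' q hq hq' => ?_⟩, hi⟩
    have cp := C p (by omega)
    rcases lt_or_ge q v with hqv | hqv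
    · have := h3 p hp hp' q hq (by omega)
      have cq := C q (by omega)
      omega
    · have := h3 p hp hp' (q + 1) (by omega) (by omega)
      have cq := C (q + 1) (by omega)
      simp only [Nat.add_sub_cancel] at cq
      omega
  · rintro ⟨⟨⟨h1, h2⟩, h3⟩, hi⟩
    refine ⟨⟨h1, by omega⟩, fun p hp hp' q hq hq' => ?_⟩
    have cp := C p (by omega)
    have cq := C q (by omega)
    have := B p (by omega)
    rcases lt_trichotomy q v with hqv | hqv | hqv
    · have := h3 p hp hp' q hq (by omega)
      omega
    · omega
    · have := h3 p hp hp' (q - 1) (by omega) (by omega)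
      omega

lemma InB.stats_cyc_mul (hw : InB n w) (h : ldes n w⁻¹ < v) (hv : v ≤ n) :
    lateCuts (n + 1) (cyc n v * w) = 0 ∧
    earlyBlocks (n + 1) (cyc n v * w) = earlyBlocks n w + (v - (n - lateCuts n w)) ∧
    runExcess (n + 1) (cyc n v * w) = n + 1 - v := by
  have hl := hw.ldes_cyc_mul h hv
  have hc := hw.cutSet_cyc_mul h hv
  have h0 : lateCuts (n + 1) (cyc n v * w) = 0 := by
    rw [lateCuts, hl, if_neg (by omega), hc, Finset.card_eq_zero, Finset.filter_filter,
      Finset.filter_eq_empty_iff]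
    intro i _
    omega
  refine ⟨h0, ?_, ?_⟩
  · have e : ((cutSet n w⁻¹).filter (· < v)).filter (· < v) = (cutSet n w⁻¹).filter (· < v) := by
      rw [Finset.filter_filter]
      simp
    rw [earlyBlocks, hl, if_neg (by omega), hc, e, ← card_cuts_lt h hv]
    omega
  · rw [runExcess, hl, h0]
    omega

lemma InB.ldes_succ (hw : InB n w) : ldes (n + 1) w⁻¹ = ldes n w⁻¹ := by
  apply ldes_eq
  · rcases Nat.eq_zero_or_pos (ldes n w⁻¹) with h | h
    · exact Or.inl h
    · right
      have := ldes_spec h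
      exact ⟨by omega, this.2⟩
  · intro i hi hi'
    rcases eq_or_lt_of_le (Nat.lt_succ_iff.1 hi') with rfl | h
    · rw [hw.inv.apply_succ]
      have := (hw.inv.bounds (i := i) (by omega) (by omega)).2
      omega
    · exact lt_of_ldes_lt hi (by omega) h

lemma InB.cutSet_succ (hw : InB n w) (hn : 0 < n) :
    cutSet (n + 1) w⁻¹ = insert n (cutSet n w⁻¹) := by
  ext i
  rw [Finset.mem_insert, mem_cutSet, mem_cutSet]
  have hs := hw.inv.apply_succ
  have B : ∀ i : ℕ, i ≤ n → w⁻¹ (i : ℤ) ≤ n := fun i hi =>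
    (hw.inv.bounds (i := i) (by omega) (by omega)).2
  constructor
  · rintro ⟨⟨h1, h2⟩, h3⟩
    rcases eq_or_ne i n with h | h
    · exact Or.inl h
    · exact Or.inr ⟨⟨h1, by omega⟩, fun p hp hp' q hq hq' => h3 p hp hp' q hq (by omega)⟩
  · intro h
    refine ⟨⟨by omega, by omega⟩, fun p hp hp' q hq hq' => ?_⟩
    rcases eq_or_lt_of_le hq' with rfl | hq'
    · rw [hs]
      have := B p (by omega)
      omega
    · rcases h with rfl | h
      · omega
      · exact h.2 p hp hp' q hq (by omega)

lemma InB.stats_succ (hw : InB n w) :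
    lateCuts (n + 1) w = lateCuts n w + 1 ∧ earlyBlocks (n + 1) w = earlyBlocks n w ∧
      runExcess (n + 1) w = runExcess n w := by
  have hc : lateCuts (n + 1) w = lateCuts n w + 1 ∧ earlyBlocks (n + 1) w = earlyBlocks n w := by
    unfold lateCuts earlyBlocks
    rw [hw.ldes_succ]
    rcases Nat.eq_zero_or_pos (ldes n w⁻¹) with h | h
    · simp [h]
    · have h1 := (ldes_spec h).1
      simp only [if_neg h.ne', hw.cutSet_succ (by omega)]
      rw [Finset.filter_insert, if_pos h1, Finset.filter_insert, if_neg (by omega),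
        Finset.card_insert_of_notMem]
      · exact ⟨rfl, rfl⟩
      · rw [Finset.mem_filter, mem_cutSet]
        omega
  refine ⟨hc.1, hc.2, ?_⟩
  rw [runExcess, runExcess, hw.ldes_succ, hc.1]
  omega

lemma IsFC.stats_of_neg (hw : IsFC (n + 1) w) (h : w ((n + 1 : ℕ) : ℤ) < 0)
    (hM : 0 < ldes (n + 1) w⁻¹) : earlyBlocks (n + 1) w = 1 ∧ runExcess (n + 1) w = 1 := by
  have hb := hw.1.bounds (i := (n + 1 : ℕ)) (by omega) le_rfl
  obtain ⟨a, ha⟩ := Int.eq_ofNat_of_zero_le (a := -w ((n + 1 : ℕ) : ℤ)) (by omega)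
  have hP : ∀ i j : ℕ, 1 ≤ i → i < j → j ≤ n → w j < |w i| → w j < 0 := fun i j hi hij hj h2 =>
    (hw.le_of_lt_abs (k := n + 1) hi hij (by omega) le_rfl h2).trans_lt h
  have hC : ∀ i j : ℕ, 1 ≤ i → i < j → j ≤ n → ¬ |w i| < -w j := fun i j hi hij hj h2 => by
    have := hw.abs_le_of_abs_lt (k := n + 1) hi hij (by omega) le_rfl h2
    have := abs_nonneg (w i)
    omega
  have hN : ∀ i : ℕ, 1 ≤ i → i ≤ n → w i < 0 → w i ≤ -a := fun i hi hi' h2 => by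
    have := hw.le_of_neg (j := n + 1) hi (by omega) le_rfl h2
    omega
  have hua : w⁻¹ (a : ℤ) = -((n + 1 : ℕ) : ℤ) := hw.1.apply_inv_neg (by omega)
  have B : ∀ i : ℕ, i ≤ n + 1 → -((n + 1 : ℕ) : ℤ) ≤ w⁻¹ (i : ℤ) := fun i hi =>
    (hw.1.inv.bounds (i := i) (by omega) (by omega)).1
  have hMa : ldes (n + 1) w⁻¹ + 1 = a := by
    have h1 : ldes (n + 1) w⁻¹ < a := by
      obtain ⟨i, j, hi, hij, hj, ⟨h2, h3⟩ | ⟨h2, h3⟩⟩ := hw.exists_of_ldes_pos hM <;>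
        rcases eq_or_lt_of_le hj with rfl | hj
      · omega
      · have := hP i j hi hij (by omega) h2
        omega
      · omega
      · exact absurd h2 (hC i j hi hij (by omega))
    have h2 := le_ldes_of_inversion (n := n + 1) (u := w⁻¹) (y := a - 1) (z := a) (by omega)
      (by omega) ?_
    · omega
    · rw [hua]
      refine lt_of_le_of_ne (B _ (by omega)) fun he => ?_
      have := w⁻¹.injective (hua.trans he)
      omega
  have hinc : ∀ p q : ℕ, 1 ≤ p → p < a → a < q → q ≤ n + 1 → w⁻¹ (p : ℤ) < w⁻¹ (q : ℤ) := by
    intro p q hp hpa haq hq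
    obtain ⟨i, hi1, hi2, hi⟩ := hw.1.exists_pos hp (by omega)
    obtain ⟨j, hj1, hj2, hj⟩ := hw.1.exists_pos (y := q) (by omega) hq
    have hi3 : i ≠ n + 1 := by
      rintro rfl
      omega
    have hj3 : j ≠ n + 1 := by
      rintro rfl
      omega
    rcases hi with ⟨hi, hi'⟩ | ⟨hi, hi'⟩
    · rw [hi']
      by_contra hc
      rcases lt_trichotomy i j with hij | rfl | hij
      · rcases hj with ⟨hj, hj'⟩ | ⟨hj, hj'⟩
        · omega
        · apply hC i j hi1 hij (by omega)
          rw [abs_lt]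
          omega
      · omega
      · have := hP j i hj1 hij (by omega) (by rw [lt_abs]; omega)
        omega
    · have := hN i hi1 (by omega) (by omega)
      omega
  have e1 : (cutSet (n + 1) w⁻¹).filter (· < ldes (n + 1) w⁻¹) = ∅ := by
    rw [Finset.filter_eq_empty_iff]
    intro i hi hi'
    rw [mem_cutSet] at hi
    have := hi.2 1 le_rfl hi.1.1 a (by omega) (by omega)
    have := B 1 (by omega)
    omega
  have e2 : (cutSet (n + 1) w⁻¹).filter (ldes (n + 1) w⁻¹ < ·) =
      Finset.Ioo (ldes (n + 1) w⁻¹) (n + 1) := by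
    ext i
    rw [Finset.mem_filter, mem_cutSet, Finset.mem_Ioo]
    refine ⟨fun h => ⟨h.2, h.1.1.2⟩, fun ⟨h1, h2⟩ => ⟨⟨⟨by omega, h2⟩, ?_⟩, h1⟩⟩
    intro p hp hp' q hq hq'
    rcases lt_or_ge p a with h3 | h3
    · exact hinc p q hp h3 (by omega) hq'
    · exact lt_of_ldes_lt (n := n + 1) (by omega) (by omega) hq'
  have hlt := (ldes_spec hM).1
  constructor
  · rw [earlyBlocks, if_neg hM.ne', e1]
    rfl
  · rw [runExcess, lateCuts, if_neg hM.ne', e2, Nat.card_Ioo]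
    omega

lemma InB.NegSet_cyc_mul (hw : InB n w) (h1 : 1 ≤ v) (h2 : v ≤ n + 1) :
    NegSet (n + 1) (cyc n v * w) = NegSet n w := by
  ext i
  simp only [NegSet, Finset.mem_filter, Finset.mem_Icc]
  rcases le_or_gt i n with h | h
  · rw [Equiv.Perm.mul_apply, cyc_neg_iff h1 h2 (hw.bounds (by omega) (by omega))]
    omega
  · refine ⟨fun ⟨h3, h4⟩ => ?_, fun h3 => by omega⟩
    obtain rfl : i = n + 1 := by omega
    rw [hw.cyc_mul_last h1 h2] at h4
    omega

lemma InB.NegSet_succ (hw : InB n w) : NegSet (n + 1) w = NegSet n w := by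
  ext i
  simp only [NegSet, Finset.mem_filter, Finset.mem_Icc]
  refine ⟨fun ⟨h3, h4⟩ => ⟨⟨h3.1, ?_⟩, h4⟩, fun h3 => ⟨by omega, h3.2⟩⟩
  by_contra hc
  obtain rfl : i = n + 1 := by omega
  rw [hw.apply_succ] at h4
  omega

lemma InB.went_le (hw : InB n w) {i : ℕ} (hi : i ≤ n) : went w i ≤ n := by
  unfold went
  split_ifs
  · omega
  · exact (hw.bounds (by omega) (by omega)).2

lemma InB.DesB_succ (hw : InB n w) : DesB (n + 1) w = DesB n w := by
  ext i
  rw [mem_DesB, mem_DesB]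
  refine ⟨fun ⟨h3, h4⟩ => ⟨?_, h4⟩, fun h3 => ⟨by omega, h3.2⟩⟩
  by_contra hc
  obtain rfl : i = n := by omega
  have := hw.went_le le_rfl
  rw [went_pos _ (by omega), hw.apply_succ] at h4
  omega

lemma went_cyc_mul (h1 : 1 ≤ v) (h2 : v ≤ n + 1) (i : ℕ) :
    went (cyc n v * w) i = cyc n v (went w i) := by
  unfold went
  split_ifs
  · rw [(InB_cyc h1 h2).zero]
  · rfl

lemma InB.DesB_cyc_mul (hw : InB n w) (h : ldes n w⁻¹ < v) (hv : v ≤ n) :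
    DesB (n + 1) (cyc n v * w) = if w n = n then insert n (DesB n w) else DesB n w := by
  have h1 : 1 ≤ v := by omega
  have h2 : v ≤ n + 1 := by omega
  have B : ∀ i ≤ n, -(n : ℤ) ≤ went w i ∧ went w i ≤ n := fun i hi => by
    refine ⟨?_, hw.went_le hi⟩
    unfold went
    split_ifs
    · omega
    · exact (hw.bounds (by omega) (by omega)).1
  have hlast : went (cyc n v * w) (n + 1) < went (cyc n v * w) n ↔ w n = n := by
    rw [went_pos _ (by omega), hw.cyc_mul_last h1 h2, went_cyc_mul h1 h2,
      cyc_lt_self_iff h1 h2 (B n le_rfl), went_pos _ (by omega)]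
    refine ⟨fun h3 => ?_, fun h3 => by omega⟩
    by_contra hc
    obtain ⟨i, hi1, hi2, hi⟩ := hw.exists_pos (y := n) (by omega) le_rfl
    have hin : i ≠ n := by
      rintro rfl
      omega
    have hle := (hw.bounds (i := n) (by omega) le_rfl).2
    have := hw.le_ldes_of_lt_abs (i := i) (j := n) (by omega) le_rfl (by rw [lt_abs]; omega)
    omega
  have hmem : ∀ i, i ∈ DesB (n + 1) (cyc n v * w) ↔ (i = n ∧ w n = n) ∨ i ∈ DesB n w := by
    intro i
    rw [mem_DesB, mem_DesB]
    rcases lt_trichotomy i n with h3 | rfl | h3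
    · rw [went_cyc_mul h1 h2, went_cyc_mul h1 h2,
        cyc_lt_iff h1 h2 (B _ (by omega)) (B _ (by omega))]
      omega
    · rw [hlast]
      omega
    · omega
  ext i
  rw [hmem]
  split_ifs with h3
  · rw [Finset.mem_insert]
    tauto
  · tauto

end append

/-! ### Trading early blocks for run excess -/

section exchange

variable {n v i j : ℕ} {u w : Equiv.Perm ℤ}

/-- `exchange n j w` keeps descents, signs, late cuts and total of `w`, but has `j` early blocks.
It is computed recursively by deleting the last letter. -/
def exchange : ℕ → ℕ → Equiv.Perm ℤ → Equiv.Perm ℤ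
  | 0, _, w => w
  | n + 1, j, w =>
    if w ((n + 1 : ℕ) : ℤ) = (n + 1 : ℕ) then exchange n j w
    else if w ((n + 1 : ℕ) : ℤ) < 0 then w
    else
      let u := (cyc n (w ((n + 1 : ℕ) : ℤ)).toNat)⁻¹ * w
      let m := total (n + 1) w
      cyc n (n + 1 - (m - j)) *
        exchange n (if m - j ≤ lateCuts n u then m - lateCuts n u - 1 else j) u

/-- The possible numbers of early blocks when the total is `m`. -/
def IsSplit (j m : ℕ) : Prop := (j = 0 ∧ m = 0) ∨ (1 ≤ j ∧ j < m)

lemma exchange_of_InB (hw : InB n w) (j : ℕ) : exchange (n + 1) j w = exchange n j w := by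
  rw [exchange, if_pos hw.apply_succ]

lemma exchange_of_neg (h : w ((n + 1 : ℕ) : ℤ) < 0) (j : ℕ) : exchange (n + 1) j w = w := by
  rw [exchange, if_neg (by omega), if_pos h]

lemma exchange_cyc_mul (hu : InB n u) (h1 : 1 ≤ v) (h2 : v ≤ n) (j : ℕ) :
    exchange (n + 1) j (cyc n v * u) = cyc n (n + 1 - (total (n + 1) (cyc n v * u) - j)) *
      exchange n (if total (n + 1) (cyc n v * u) - j ≤ lateCuts n u
        then total (n + 1) (cyc n v * u) - lateCuts n u - 1 else j) u := by
  have hl := hu.cyc_mul_last h1 (by omega)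
  rw [exchange, hl, if_neg (by omega), if_neg (by omega)]
  simp only [Int.toNat_natCast, inv_mul_cancel_left]

lemma IsFC.last_cases (hw : IsFC (n + 1) w) :
    IsFC n w ∨ w ((n + 1 : ℕ) : ℤ) < 0 ∨
      ∃ v u, v ≤ n ∧ IsFC n u ∧ ldes n u⁻¹ < v ∧ w = cyc n v * u := by
  rcases lt_or_ge (w ((n + 1 : ℕ) : ℤ)) 0 with h | h
  · exact Or.inr (Or.inl h)
  rcases eq_or_ne (w ((n + 1 : ℕ) : ℤ)) (n + 1 : ℕ) with h' | h'
  · exact Or.inl (hw.of_succ (hw.1.of_succ h'))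
  obtain ⟨v, hv⟩ := Int.eq_ofNat_of_zero_le h
  have h0 := hw.1.ne_zero (i := (n + 1 : ℕ)) (by omega)
  have hb := (hw.1.bounds (i := (n + 1 : ℕ)) (by omega) le_rfl).2
  have hu := hw.1.del (v := v) (by omega) (by omega) hv
  have hfc := IsFC.of_cyc_mul (v := v) hu (by omega) (by omega) (by rwa [mul_inv_cancel_left])
  exact Or.inr (Or.inr ⟨v, _, by omega, hfc.1, hfc.2, (mul_inv_cancel_left _ _).symm⟩)

lemma IsFC.succ (hw : IsFC n w) : IsFC (n + 1) w := by
  have e : cyc n (n + 1) = 1 := by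
    ext y
    rw [cyc_apply (by omega) le_rfl, Equiv.Perm.one_apply]
    split_ifs <;> omega
  have h := (stats_bounds n w).1
  have := hw.cyc_mul (v := n + 1) (by omega) le_rfl
  rwa [e, one_mul] at this

lemma isSplit_earlyBlocks (n : ℕ) (w : Equiv.Perm ℤ) : IsSplit (earlyBlocks n w) (total n w) := by
  have := stats_bounds n w
  unfold IsSplit total
  omega

lemma isSplit_runExcess (n : ℕ) (w : Equiv.Perm ℤ) : IsSplit (runExcess n w) (total n w) := by
  have := stats_bounds n w
  unfold IsSplit total
  omega

lemma IsFC.eq_earlyBlocks_of_neg (hw : IsFC (n + 1) w) (h : w ((n + 1 : ℕ) : ℤ) < 0)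
    (hj : IsSplit j (total (n + 1) w)) : j = earlyBlocks (n + 1) w := by
  have h1 := stats_bounds (n + 1) w
  have h2 := hw.stats_of_neg h
  unfold IsSplit total at hj
  omega

/-- `z` has the same descents, signs and late cuts as `w`, and `j` early blocks. -/
structure IsExchange (n j : ℕ) (w z : Equiv.Perm ℤ) : Prop where
  isFC : IsFC n z
  lateCuts_eq : lateCuts n z = lateCuts n w
  earlyBlocks_eq : earlyBlocks n z = j
  total_eq : total n z = total n w
  DesB_eq : DesB n z = DesB n w
  NegSet_eq : NegSet n z = NegSet n w
  last_iff : z n = n ↔ w n = n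

lemma IsFC.isExchange_self (hw : IsFC n w) : IsExchange n (earlyBlocks n w) w w :=
  ⟨hw, rfl, rfl, rfl, rfl, rfl, Iff.rfl⟩

lemma IsExchange.succ {z : Equiv.Perm ℤ} (hw : InB n w) (h : IsExchange n j w z) :
    IsExchange (n + 1) j w z := by
  have s := hw.stats_succ
  have t := h.isFC.1.stats_succ
  have h1 := h.lateCuts_eq
  have h2 := h.earlyBlocks_eq
  have h3 := h.total_eq
  unfold total at h3
  refine ⟨h.isFC.succ, by omega, by omega, by unfold total; omega, ?_, ?_, ?_⟩
  · rw [hw.DesB_succ, h.isFC.1.DesB_succ, h.DesB_eq]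
  · rw [hw.NegSet_succ, h.isFC.1.NegSet_succ, h.NegSet_eq]
  · rw [hw.apply_succ, h.isFC.1.apply_succ]

/-- The parameters of the recursive step of `exchange` are admissible. -/
lemma isSplit_step (hu : InB n u) (hv : ldes n u⁻¹ < v) (hv' : v ≤ n)
    (hj : IsSplit j (total (n + 1) (cyc n v * u))) :
    IsSplit (if total (n + 1) (cyc n v * u) - j ≤ lateCuts n u
        then total (n + 1) (cyc n v * u) - lateCuts n u - 1 else j) (total n u) := by
  have s := hu.stats_cyc_mul hv hv'
  have b := stats_bounds n u
  unfold IsSplit total at *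
  split_ifs <;> omega

lemma IsExchange.cyc_mul {k : ℕ} {z : Equiv.Perm ℤ} (hu : InB n u) (hv : ldes n u⁻¹ < v)
    (hv' : v ≤ n) (hj : IsSplit j (total (n + 1) (cyc n v * u)))
    (hk : k = if total (n + 1) (cyc n v * u) - j ≤ lateCuts n u
      then total (n + 1) (cyc n v * u) - lateCuts n u - 1 else j)
    (h : IsExchange n k u z) :
    IsExchange (n + 1) j (cyc n v * u)
      (cyc n (n + 1 - (total (n + 1) (cyc n v * u) - j)) * z) ∧
    ldes n z⁻¹ < n + 1 - (total (n + 1) (cyc n v * u) - j) ∧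
    n + 1 - (total (n + 1) (cyc n v * u) - j) ≤ n := by
  have s := hu.stats_cyc_mul hv hv'
  have b := stats_bounds n u
  have b' := stats_bounds n z
  have h1 := h.lateCuts_eq
  have h2 := h.earlyBlocks_eq
  have h3 := h.total_eq
  have hT : total (n + 1) (cyc n v * u) =
    earlyBlocks n u + (v - (n - lateCuts n u)) + (n + 1 - v) := by
    unfold total
    omega
  unfold total at h3
  unfold IsSplit at hj
  generalize total (n + 1) (cyc n v * u) = T at *
  have hz : ldes n z⁻¹ < n + 1 - (T - j) ∧ n + 1 - (T - j) ≤ n := by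
    split_ifs at hk <;> omega
  refine ⟨?_, hz⟩
  have t := h.isFC.1.stats_cyc_mul hz.1 hz.2
  refine ⟨h.isFC.cyc_mul hz.1 (by omega), by omega, ?_, ?_, ?_, ?_, ?_⟩
  · split_ifs at hk <;> omega
  · unfold total
    split_ifs at hk <;> omega
  · rw [hu.DesB_cyc_mul hv hv', h.isFC.1.DesB_cyc_mul hz.1 hz.2, h.DesB_eq]
    simp only [h.last_iff]
  · rw [hu.NegSet_cyc_mul (by omega) (by omega), h.isFC.1.NegSet_cyc_mul (by omega) (by omega),
      h.NegSet_eq]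
  · rw [hu.cyc_mul_last (by omega) (by omega), h.isFC.1.cyc_mul_last (by omega) (by omega)]
    omega

theorem IsFC.exchange_spec (hw : IsFC n w) (hj : IsSplit j (total n w)) :
    IsExchange n j w (exchange n j w) ∧
      ∀ i, IsSplit i (total n w) → exchange n i (exchange n j w) = exchange n i w := by
  induction n generalizing w j with
  | zero =>
    have h := stats_bounds 0 w
    obtain rfl : j = earlyBlocks 0 w := by
      unfold IsSplit total at hj
      omega
    exact ⟨hw.isExchange_self, fun _ _ => rfl⟩
  | succ n ih =>
    rcases hw.last_cases with h | h | ⟨v, u, hv', hu, hv, rfl⟩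
    · have e : total (n + 1) w = total n w := by
        rw [total, total, h.1.stats_succ.2.1, h.1.stats_succ.2.2]
      rw [e] at hj ⊢
      obtain ⟨h1, h2⟩ := ih h hj
      simp only [exchange_of_InB h.1, exchange_of_InB h1.isFC.1]
      exact ⟨h1.succ h.1, h2⟩
    · obtain rfl := hw.eq_earlyBlocks_of_neg h hj
      simp only [exchange_of_neg h]
      exact ⟨hw.isExchange_self, fun _ _ => trivial⟩
    · obtain ⟨h1, h2⟩ := ih hu (isSplit_step hu.1 hv hv' hj)
      obtain ⟨h3, h4, h5⟩ := h1.cyc_mul hu.1 hv hv' hj rfl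
      rw [exchange_cyc_mul hu.1 (by omega) hv']
      refine ⟨h3, fun i hi => ?_⟩
      rw [exchange_cyc_mul h1.isFC.1 (by omega) h5, exchange_cyc_mul hu.1 (by omega) hv',
        h3.total_eq, h1.lateCuts_eq, h2 _ (isSplit_step hu.1 hv hv' hi)]

theorem IsFC.exchange_earlyBlocks (hw : IsFC n w) : exchange n (earlyBlocks n w) w = w := by
  induction n generalizing w with
  | zero => rfl
  | succ n ih =>
    rcases hw.last_cases with h | h | ⟨v, u, hv', hu, hv, rfl⟩
    · rw [exchange_of_InB h.1, h.1.stats_succ.2.1, ih h]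
    · exact exchange_of_neg h _
    · have s := hu.1.stats_cyc_mul hv hv'
      have b := stats_bounds n u
      have e1 : n + 1 - (total (n + 1) (cyc n v * u) - earlyBlocks (n + 1) (cyc n v * u)) = v := by
        unfold total
        omega
      have e2 : (if total (n + 1) (cyc n v * u) - earlyBlocks (n + 1) (cyc n v * u) ≤ lateCuts n u
          then total (n + 1) (cyc n v * u) - lateCuts n u - 1
          else earlyBlocks (n + 1) (cyc n v * u)) = earlyBlocks n u := by
        unfold total
        split_ifs <;> omega
      rw [exchange_cyc_mul hu.1 (by omega) hv', e1, e2, ih hu]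

end exchange

theorem exists_involution_Phi (n : ℕ) (hn : 0 < n) :
    ∃ Φ : Equiv.Perm ℤ → Equiv.Perm ℤ,
      (∀ w, IsFC n w → IsFC n (Φ w)) ∧
      (∀ w, IsFC n w → Φ (Φ w) = w) ∧
      ∀ w, IsFC n w →
        DesB n (Φ w) = DesB n w ∧ NegSet n (Φ w) = NegSet n w ∧
        bl n w⁻¹ = n - ldes n (Φ w)⁻¹ := by
  have key : ∀ w, IsFC n w → runExcess n (exchange n (runExcess n w) w) = earlyBlocks n w := by
    intro w hw
    have h := (hw.exchange_spec (isSplit_runExcess n w)).1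
    have h1 := h.earlyBlocks_eq
    have h2 := h.total_eq
    unfold total at h2
    omega
  refine ⟨fun w => exchange n (runExcess n w) w, fun w hw => ?_, fun w hw => ?_, fun w hw => ?_⟩
  · exact (hw.exchange_spec (isSplit_runExcess n w)).1.isFC
  · dsimp only
    rw [key w hw, (hw.exchange_spec (isSplit_runExcess n w)).2 _ (isSplit_earlyBlocks n w),
      hw.exchange_earlyBlocks]
  · have h := (hw.exchange_spec (isSplit_runExcess n w)).1
    refine ⟨h.DesB_eq, h.NegSet_eq, ?_⟩
    have h1 := (stats_bounds n (exchange n (runExcess n w) w)).1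
    have h2 := key w hw
    have h3 := h.lateCuts_eq
    rw [bl_inv_eq hn]
    dsimp only
    omega

end Paper
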